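/- Let X be an O-regular compact set in C^n, i.e., the set O_X is closed, and let phi be a real-valued continuous function on B_X. For every epsilon > 0 there is a real-valued continuous plurisubharmonic function u on X (u in PSH^c(X)) such that phi - epsilon <= u <= phi on B_X and u >= min over z in B_X of phi(z) on all of X. -/

import Mathlib

open MeasureTheory Metric Filter Topology Set Complex
open scoped ENNReal

noncomputable section

/-- `ℂⁿ`. -/
abbrev En (n : ℕ) : Type := EuclideanSpace ℂ (Fin n)

instance (n : ℕ) : MeasurableSpace (En n) := borel _

instance (n : ℕ) : BorelSpace (En n) := ⟨rfl⟩

open Classical in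
/-- The positive part of an extended real number, as an element of `ℝ≥0∞`. -/
def epos (x : EReal) : ℝ≥0∞ := if x = ⊤ then ⊤ else ENNReal.ofReal x.toReal

/-- The integral of an `EReal`-valued function `u` against a measure `μ`, defined as the
difference of the lower integrals of the positive and negative parts of `u`. -/
def eint {α : Type*} [MeasurableSpace α] (μ : Measure α) (u : α → EReal) : EReal :=
  ((∫⁻ x, epos (u x) ∂μ : ℝ≥0∞) : EReal) - ((∫⁻ x, epos (-(u x)) ∂μ : ℝ≥0∞) : EReal)

/-- The normalized angular measure `(2π)⁻¹ dθ` on `[0, 2π)`. -/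
def thetaM : Measure ℝ :=
  (ENNReal.ofReal ((2 * Real.pi)⁻¹)) • (volume.restrict (Set.Ico (0 : ℝ) (2 * Real.pi)))

/-- A function `u` with values in `[-∞, ∞)` is plurisubharmonic on an open set `U ⊆ ℂⁿ`:
it is upper semicontinuous, `< ⊤`, and satisfies the sub-mean-value inequality on every
complex line. -/
def PshOnE {n : ℕ} (u : En n → EReal) (U : Set (En n)) : Prop :=
  UpperSemicontinuousOn u U ∧ (∀ z ∈ U, u z < ⊤) ∧
  ∀ z ∈ U, ∀ w : En n, ∀ r : ℝ, 0 < r →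
    (∀ ζ : ℂ, ‖ζ‖ ≤ r → z + ζ • w ∈ U) →
    u z ≤ eint thetaM (fun θ => u (z + (circleMap 0 r θ) • w))

/-- `μ` is a Jensen measure on `X` with barycenter `z`:  a Borel probability measure
supported on `X` such that `u z ≤ ∫ u dμ` for every function `u` continuous and
plurisubharmonic on some open neighborhood of `X`. -/
def IsJensen {n : ℕ} (X : Set (En n)) (z : En n) (μ : Measure (En n)) : Prop :=
  IsProbabilityMeasure μ ∧ μ Xᶜ = 0 ∧
  ∀ U : Set (En n), IsOpen U → X ⊆ U →
    ∀ u : En n → EReal, ContinuousOn u U → PshOnE u U → u z ≤ eint μ u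

/-- `u : X → [-∞, ∞)` is plurisubharmonic on the compact set `X` : it is upper
semicontinuous on `X`, `< ⊤` on `X`, and satisfies the subaveraging inequality with respect
to all Jensen measures on `X`. -/
def PSHe {n : ℕ} (X : Set (En n)) (u : En n → EReal) : Prop :=
  UpperSemicontinuousOn u X ∧ (∀ z ∈ X, u z < ⊤) ∧
  ∀ z ∈ X, ∀ μ : Measure (En n), IsJensen X z μ → u z ≤ eint μ u

/-- `PSH^c(X)`: continuous plurisubharmonic functions on `X`. -/
def PSHce {n : ℕ} (X : Set (En n)) (u : En n → EReal) : Prop :=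
  PSHe X u ∧ ContinuousOn u X

/-- Real-valued continuous plurisubharmonic functions on `X`. -/
def PSHcR {n : ℕ} (X : Set (En n)) (u : En n → ℝ) : Prop :=
  ContinuousOn u X ∧ PSHe X (fun x => (u x : EReal))

/-- `O_X`: the set of points `z ∈ X` whose only Jensen measure is `δ_z`. -/
def Oset {n : ℕ} (X : Set (En n)) : Set (En n) :=
  {z | z ∈ X ∧ ∀ μ : Measure (En n), IsJensen X z μ → μ = Measure.dirac z}

/-- The potential boundary `B_X`, the closure of `O_X`. -/
def Bset {n : ℕ} (X : Set (En n)) : Set (En n) := closure (Oset X)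

/-- `J^b_z(X)`: Jensen measures with barycenter `z` supported on `B_X`. -/
def IsJensenB {n : ℕ} (X : Set (En n)) (z : En n) (μ : Measure (En n)) : Prop :=
  IsJensen X z μ ∧ μ (Bset X)ᶜ = 0

/-- `ν` is subordinated to `μ` : `μ(u) ≥ ν(u)` for all `u ∈ PSH^c(X)`. -/
def Subord {n : ℕ} (X : Set (En n)) (μ ν : Measure (En n)) : Prop :=
  ∀ u : En n → EReal, PSHce X u → eint ν u ≤ eint μ u

/-- Subharmonic functions with values in `[-∞, ∞)` on an open set `U ⊆ ℂ`. -/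
def SubharmOn (u : ℂ → EReal) (U : Set ℂ) : Prop :=
  UpperSemicontinuousOn u U ∧ (∀ z ∈ U, u z < ⊤) ∧
  ∀ z ∈ U, ∀ r : ℝ, 0 < r → closedBall z r ⊆ U →
    u z ≤ eint thetaM (fun θ => u (circleMap z r θ))

/-- Harmonic (real-valued) functions on an open set `U ⊆ ℂ`: continuous functions
satisfying the mean-value equality. -/
def HarmOn (h : ℂ → ℝ) (U : Set ℂ) : Prop :=
  ContinuousOn h U ∧
  ∀ z ∈ U, ∀ r : ℝ, 0 < r → closedBall z r ⊆ U →
    h z = (2 * Real.pi)⁻¹ * ∫ θ in (0 : ℝ)..(2 * Real.pi), h (circleMap z r θ)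

/-- Superharmonic (real-valued) functions on an open set `U ⊆ ℂ`. -/
def SuperharmOn (v : ℂ → ℝ) (U : Set ℂ) : Prop :=
  LowerSemicontinuousOn v U ∧
  ∀ z ∈ U, ∀ r : ℝ, 0 < r → closedBall z r ⊆ U →
    (2 * Real.pi)⁻¹ * (∫ θ in (0 : ℝ)..(2 * Real.pi), v (circleMap z r θ)) ≤ v z

/-- The infimum of all positive superharmonic functions on the unit disk, extending
continuously to the closed disk and `≥ 1` on `A`, evaluated at `z`. -/
def hmPre (A : Set ℂ) (z : ℂ) : ℝ :=
  sInf {t : ℝ | ∃ v : ℂ → ℝ, SuperharmOn v (ball 0 1) ∧ (∀ w ∈ ball (0 : ℂ) 1, 0 < v w) ∧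
    ContinuousOn v (closedBall 0 1) ∧ (∀ w ∈ A, 1 ≤ v w) ∧ t = v z}

/-- The harmonic measure `ω(z, A, 𝔻)` of `A` with respect to the unit disk. -/
def hm (z : ℂ) (A : Set ℂ) : ℝ := Filter.liminf (fun w => hmPre A w) (𝓝 z)

open Classical in
/-- The radial limit of a map `f` at the boundary point `ζ` of the unit circle
(junk value `0` if the radial limit does not exist). -/
def bval {n : ℕ} (f : ℂ → En n) (ζ : ℂ) : En n :=
  if h : ∃ l : En n, Tendsto (fun r : ℝ => f ((r : ℂ) * ζ)) (𝓝[<] (1 : ℝ)) (𝓝 l)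
  then h.choose else 0

open Classical in
/-- The radial limit of an `EReal`-valued function on the disk at the boundary point `ζ`. -/
def bvalE (g : ℂ → EReal) (ζ : ℂ) : EReal :=
  if h : ∃ l : EReal, Tendsto (fun r : ℝ => g ((r : ℂ) * ζ)) (𝓝[<] (1 : ℝ)) (𝓝 l)
  then h.choose else 0

/-- `μ_f`: the push-forward of the normalized arclength measure on the unit circle under the
radial boundary values of `f`. -/
def bmeas {n : ℕ} (f : ℂ → En n) : Measure (En n) :=
  thetaM.map (fun θ => bval f (circleMap 0 1 θ))

/-- Weak-* convergence of a sequence of measures on `ℂⁿ`. -/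
def WeakConv {n : ℕ} (μs : ℕ → Measure (En n)) (μ : Measure (En n)) : Prop :=
  ∀ φ : BoundedContinuousFunction (En n) ℝ,
    Tendsto (fun j => ∫ x, φ x ∂(μs j)) atTop (𝓝 (∫ x, φ x ∂μ))

/-- The cluster set `cl L` of a sequence of maps of the unit disk into `ℂⁿ`. -/
def clusterSet {n : ℕ} (f : ℕ → ℂ → En n) : Set (En n) :=
  {z | ∀ r : ℝ, 0 < r → ∀ N : ℕ, ∃ j, N ≤ j ∧ ∃ ζ ∈ ball (0 : ℂ) 1, f j ζ ∈ ball z r}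

/-- A point `z` is totally essential for the sequence `f` if for every open set `V ∋ z` the
harmonic measures at `0` of `f j ⁻¹' V` stay bounded away from `0`. -/
def TotallyEssential {n : ℕ} (f : ℕ → ℂ → En n) (z : En n) : Prop :=
  ∀ V : Set (En n), IsOpen V → z ∈ V →
    0 < Filter.atTop.liminf (fun j => hm 0 ((f j ⁻¹' V) ∩ ball 0 1))

/-- A totally perfect sequence `L` of holomorphic maps of the unit disk into `ℂⁿ`: a
uniformly bounded sequence of holomorphic maps which is weak-* converging (with limit measure
`μ_L` and center `z_L`) and all of whose cluster points are totally essential. -/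
structure PerfectSeq (n : ℕ) where
  f : ℕ → ℂ → En n
  holo : ∀ j, DifferentiableOn ℂ (f j) (ball 0 1)
  bdd : ∃ C : ℝ, ∀ j, ∀ ζ ∈ ball (0 : ℂ) 1, ‖f j ζ‖ ≤ C
  μL : Measure (En n)
  conv : WeakConv (fun j => bmeas (f j)) μL
  zL : En n
  center : Tendsto (fun j => f j 0) atTop (𝓝 zL)
  ess : ∀ z ∈ clusterSet f, TotallyEssential f z

/-- `J_z^s(L)`: the measures obtained as weak-* limits of `μ_{f_{j_k} ∘ g_k}` for subsequences
`{j_k}` and holomorphic maps `g_k : 𝔻 → 𝔻` with `f_{j_k}(g_k(0)) → z`. -/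
def JsSet {n : ℕ} (L : PerfectSeq n) (z : En n) : Set (Measure (En n)) :=
  {μ | ∃ jk : ℕ → ℕ, StrictMono jk ∧ ∃ g : ℕ → ℂ → ℂ,
    (∀ k, DifferentiableOn ℂ (g k) (ball 0 1) ∧ MapsTo (g k) (ball 0 1) (ball 0 1)) ∧
    WeakConv (fun k => bmeas ((L.f (jk k)) ∘ (g k))) μ ∧
    Tendsto (fun k => L.f (jk k) (g k 0)) atTop (𝓝 z)}

/-- `J_z(L)`: the convex hull of `J_z^s(L)`. -/
def JLSet {n : ℕ} (L : PerfectSeq n) (z : En n) : Set (Measure (En n)) :=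
  {μ | ∃ (m : ℕ) (w : Fin m → ℝ) (ν : Fin m → Measure (En n)),
    (∀ i, 0 ≤ w i) ∧ (∑ i, w i = 1) ∧ (∀ i, ν i ∈ JsSet L z) ∧
    μ = ∑ i, (ENNReal.ofReal (w i)) • ν i}

/-- `u` is harmonic on the totally perfect sequence `L`. -/
def HarmonicOnL {n : ℕ} (L : PerfectSeq n) (u : En n → EReal) : Prop :=
  PSHce (clusterSet L.f) u ∧
  ∀ z ∈ clusterSet L.f, ∀ μ ∈ JLSet L z, eint μ u = u z

/-- `PSH^w(X)`: weakly plurisubharmonic functions, the upper envelopes of nonempty families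
of continuous plurisubharmonic functions on `X`. -/
def PSHw {n : ℕ} (X : Set (En n)) (u : En n → EReal) : Prop :=
  ∃ F : Set (En n → EReal), F.Nonempty ∧ (∀ v ∈ F, PSHce X v) ∧
    ∀ x ∈ X, u x = ⨆ v ∈ F, v x

/-- `u` is maximal on `X ∖ Z`: for every relatively open `V ⊆ X ∖ Z` and every
`v ∈ PSH^c(closure V)`, if `v ≤ u` on the relative boundary of `V` in `X` then `v ≤ u`
on `closure V`. -/
def MaximalOn {n : ℕ} (X Z : Set (En n)) (u : En n → EReal) : Prop :=
  ∀ W : Set (En n), IsOpen W → X ∩ W ⊆ X \ Z →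
    ∀ v : En n → EReal, PSHce (closure (X ∩ W)) v →
      (∀ x ∈ closure (X ∩ W) \ (X ∩ W), v x ≤ u x) →
      ∀ x ∈ closure (X ∩ W), v x ≤ u x

/-- Pluriharmonic continuous real-valued functions on `X`. -/
def Pluriharm {n : ℕ} (X : Set (En n)) (h : En n → ℝ) : Prop :=
  ContinuousOn h X ∧
  ∀ z ∈ X, ∀ μ : Measure (En n), IsJensen X z μ → (h z : EReal) = eint μ (fun x => (h x : EReal))

/-- `X` is a Poisson set: every continuous real-valued function on `B_X` extends to a
pluriharmonic function on `X`. -/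
def PoissonSet {n : ℕ} (X : Set (En n)) : Prop :=
  ∀ φ : En n → ℝ, ContinuousOn φ (Bset X) →
    ∃ h : En n → ℝ, Pluriharm X h ∧ ∀ w ∈ Bset X, h w = φ w

end

section ExtendedIntegral

variable {α : Type*} [MeasurableSpace α] {μ : Measure α}

lemma epos_eq_toENNReal (x : EReal) : epos x = x.toENNReal := rfl

lemma eint_mono_ae {u v : α → EReal} (h : ∀ᵐ x ∂μ, u x ≤ v x) : eint μ u ≤ eint μ v := by
  unfold eint
  refine EReal.sub_le_sub ?_ ?_
  · refine EReal.coe_ennreal_le_coe_ennreal_iff.2 (lintegral_mono_ae ?_)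
    filter_upwards [h] with x hx using EReal.toENNReal_le_toENNReal hx
  · refine EReal.coe_ennreal_le_coe_ennreal_iff.2 (lintegral_mono_ae ?_)
    filter_upwards [h] with x hx
    exact EReal.toENNReal_le_toENNReal (EReal.neg_le_neg_iff.2 hx)

lemma eint_congr_ae {u v : α → EReal} (h : ∀ᵐ x ∂μ, u x = v x) : eint μ u = eint μ v :=
  le_antisymm (eint_mono_ae (h.mono fun _ hx => hx.le)) (eint_mono_ae (h.mono fun _ hx => hx.ge))

lemma eint_coe {f : α → ℝ} (hf : Integrable f μ) :
    eint μ (fun x => (f x : EReal)) = ((∫ x, f x ∂μ : ℝ) : EReal) := by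
  have h1 : ∫⁻ x, ENNReal.ofReal (f x) ∂μ ≠ ⊤ := hf.lintegral_lt_top.ne
  have h2 : ∫⁻ x, ENNReal.ofReal (-f x) ∂μ ≠ ⊤ := hf.neg.lintegral_lt_top.ne
  rw [integral_eq_lintegral_pos_part_sub_lintegral_neg_part hf, EReal.coe_sub,
    EReal.coe_ennreal_toReal h1, EReal.coe_ennreal_toReal h2]
  rfl

/-- Monotone convergence along the truncations `max u (-k)`. -/
lemma le_eint_of_forall_le_eint_max {u : α → EReal} (hu : AEMeasurable u μ)
    (hfin : ∫⁻ x, (u x).toENNReal ∂μ ≠ ⊤) {a : EReal}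
    (h : ∀ k : ℕ, a ≤ eint μ (fun x => max (u x) ((-(k : ℝ) : ℝ) : EReal))) :
    a ≤ eint μ u := by
  have hpos : ∀ k : ℕ, ∀ x, (max (u x) ((-(k : ℝ) : ℝ) : EReal)).toENNReal = (u x).toENNReal := by
    intro k x
    have hk : ((-(k : ℝ) : ℝ) : EReal) ≤ 0 := by
      exact_mod_cast neg_nonpos.2 (Nat.cast_nonneg (α := ℝ) k)
    have hm : Monotone EReal.toENNReal := fun _ _ h => EReal.toENNReal_le_toENNReal h
    rw [hm.map_max, EReal.toENNReal_of_nonpos hk]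
    simp
  have hneg : ∀ k : ℕ, ∀ x,
      (-max (u x) ((-(k : ℝ) : ℝ) : EReal)).toENNReal = min (-(u x)).toENNReal (k : ℝ≥0∞) := by
    intro k x
    have hm : Monotone EReal.toENNReal := fun _ _ h => EReal.toENNReal_le_toENNReal h
    have ha : Antitone fun y : EReal => -y := fun _ _ h => EReal.neg_le_neg_iff.2 h
    rw [ha.map_max, hm.map_min, EReal.coe_neg, neg_neg, EReal.real_coe_toENNReal,
      ENNReal.ofReal_natCast]
  set A : ℝ≥0∞ := ∫⁻ x, (u x).toENNReal ∂μ with hA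
  have hAB : ∀ k : ℕ, a + ((∫⁻ x, min (-(u x)).toENNReal (k : ℝ≥0∞) ∂μ : ℝ≥0∞) : EReal) ≤ A := by
    intro k
    have := h k
    simp only [eint, epos_eq_toENNReal, hpos, hneg] at this
    exact (EReal.le_sub_iff_add_le (Or.inl (EReal.coe_ennreal_ne_bot _))
      (Or.inr (by simpa using hfin))).1 this
  have hsup : ∫⁻ x, (-(u x)).toENNReal ∂μ =
      ⨆ k : ℕ, ∫⁻ x, min (-(u x)).toENNReal (k : ℝ≥0∞) ∂μ := by
    rw [← lintegral_iSup']
    · refine lintegral_congr fun x => ?_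
      rw [← inf_iSup_eq (f := fun k : ℕ => (k : ℝ≥0∞)), ENNReal.iSup_natCast, inf_top_eq]
    · intro k
      exact (hu.neg.ereal_toENNReal).min aemeasurable_const
    · refine Eventually.of_forall fun x i j hij => ?_
      exact min_le_min_left _ (by exact_mod_cast hij)
  unfold eint
  simp only [epos_eq_toENNReal]
  rw [EReal.le_sub_iff_add_le (Or.inl (EReal.coe_ennreal_ne_bot _)) (Or.inr (by simpa using hfin))]
  induction a with
  | bot => simp
  | top =>
    have := hAB 0
    simp at this
    exact absurd this hfin
  | coe a =>
    have hB : ∫⁻ x, (-(u x)).toENNReal ∂μ ≤ ((A : EReal) - a).toENNReal := by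
      rw [hsup]
      refine iSup_le fun k => ?_
      have h1 := EReal.toENNReal_le_toENNReal
        ((EReal.le_sub_iff_add_le (Or.inl (EReal.coe_ne_bot a)) (Or.inl (EReal.coe_ne_top a))).2
          ((add_comm _ _).trans_le (hAB k)))
      rwa [EReal.toENNReal_coe] at h1
    have h0 : (0 : EReal) ≤ (A : EReal) - a := by
      refine (EReal.le_sub_iff_add_le (Or.inl (EReal.coe_ne_bot a))
        (Or.inl (EReal.coe_ne_top a))).2 ?_
      have := hAB 0
      simpa using this
    have h2 := EReal.coe_ennreal_le_coe_ennreal_iff.2 hB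
    rw [EReal.coe_toENNReal h0] at h2
    rw [add_comm]
    exact (EReal.le_sub_iff_add_le (Or.inl (EReal.coe_ne_bot a)) (Or.inl (EReal.coe_ne_top a))).1 h2

end ExtendedIntegral

instance isProbabilityMeasure_thetaM : IsProbabilityMeasure thetaM := by
  constructor
  have hpi : (0 : ℝ) < 2 * Real.pi := by positivity
  rw [thetaM, Measure.smul_apply, Measure.restrict_apply_univ, Real.volume_Ico, sub_zero,
    smul_eq_mul, ← ENNReal.ofReal_mul (by positivity), inv_mul_cancel₀ hpi.ne', ENNReal.ofReal_one]

lemma Continuous.integrable_thetaM {f : ℝ → ℝ} (hf : Continuous f) : Integrable f thetaM := by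
  refine Integrable.smul_measure ?_ ENNReal.ofReal_ne_top
  exact (hf.continuousOn.integrableOn_compact isCompact_Icc).mono_set Ico_subset_Icc_self

section RealPsh

variable {n : ℕ}

/-- Real-valued continuous plurisubharmonic functions on an open set. -/
def PshReal (g : En n → ℝ) (U : Set (En n)) : Prop :=
  ContinuousOn g U ∧ ∀ z ∈ U, ∀ w : En n, ∀ r : ℝ, 0 < r →
    (∀ ζ : ℂ, ‖ζ‖ ≤ r → z + ζ • w ∈ U) →
    g z ≤ ∫ θ, g (z + (circleMap 0 r θ) • w) ∂thetaM

lemma circle_mem {U : Set (En n)} {z w : En n} {r : ℝ} (hr : 0 < r)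
    (h : ∀ ζ : ℂ, ‖ζ‖ ≤ r → z + ζ • w ∈ U) (θ : ℝ) : z + (circleMap 0 r θ) • w ∈ U :=
  h _ (by simp [abs_of_pos hr])

lemma integrable_circle {U : Set (En n)} {g : En n → ℝ} (hg : ContinuousOn g U)
    {z w : En n} {r : ℝ} (hr : 0 < r) (h : ∀ ζ : ℂ, ‖ζ‖ ≤ r → z + ζ • w ∈ U) :
    Integrable (fun θ => g (z + (circleMap 0 r θ) • w)) thetaM := by
  refine Continuous.integrable_thetaM (hg.comp_continuous ?_ (circle_mem hr h))
  have := continuous_circleMap 0 r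
  fun_prop

namespace PshReal

variable {g g₁ g₂ : En n → ℝ} {U V : Set (En n)}

lemma mono (hg : PshReal g U) (h : V ⊆ U) : PshReal g V :=
  ⟨hg.1.mono h, fun z hz w r hr hd => hg.2 z (h hz) w r hr fun ζ hζ => h (hd ζ hζ)⟩

lemma const (c : ℝ) : PshReal (fun _ : En n => c) U :=
  ⟨continuousOn_const, fun z _ w r _ _ => by simp⟩

lemma add (h₁ : PshReal g₁ U) (h₂ : PshReal g₂ U) : PshReal (fun x => g₁ x + g₂ x) U := by
  refine ⟨h₁.1.add h₂.1, fun z hz w r hr hd => ?_⟩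
  rw [integral_add (integrable_circle h₁.1 hr hd) (integrable_circle h₂.1 hr hd)]
  exact add_le_add (h₁.2 z hz w r hr hd) (h₂.2 z hz w r hr hd)

lemma const_mul (hg : PshReal g U) {c : ℝ} (hc : 0 ≤ c) : PshReal (fun x => c * g x) U := by
  refine ⟨continuousOn_const.mul hg.1, fun z hz w r hr hd => ?_⟩
  rw [integral_const_mul]
  exact mul_le_mul_of_nonneg_left (hg.2 z hz w r hr hd) hc

lemma sup (h₁ : PshReal g₁ U) (h₂ : PshReal g₂ U) : PshReal (fun x => max (g₁ x) (g₂ x)) U := by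
  have hc : ContinuousOn (fun x => max (g₁ x) (g₂ x)) U := h₁.1.sup h₂.1
  refine ⟨hc, fun z hz w r hr hd => max_le ?_ ?_⟩
  · exact (h₁.2 z hz w r hr hd).trans (integral_mono (integrable_circle h₁.1 hr hd)
      (integrable_circle hc hr hd) fun _ => le_max_left _ _)
  · exact (h₂.2 z hz w r hr hd).trans (integral_mono (integrable_circle h₂.1 hr hd)
      (integrable_circle hc hr hd) fun _ => le_max_right _ _)

lemma continuousOn_coe (hg : PshReal g U) : ContinuousOn (fun x => (g x : EReal)) U :=
  continuous_coe_real_ereal.comp_continuousOn hg.1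

lemma pshOnE (hg : PshReal g U) : PshOnE (fun x => (g x : EReal)) U := by
  refine ⟨hg.continuousOn_coe.upperSemicontinuousOn, fun z _ => EReal.coe_lt_top _,
    fun z hz w r hr hd => ?_⟩
  rw [eint_coe (integrable_circle hg.1 hr hd)]
  exact EReal.coe_le_coe_iff.2 (hg.2 z hz w r hr hd)

end PshReal

lemma coe_toReal_max {x : EReal} (hx : x < ⊤) (c : ℝ) :
    ((max x (c : EReal)).toReal : EReal) = max x (c : EReal) :=
  EReal.coe_toReal (max_lt hx (EReal.coe_lt_top c)).ne
    ((EReal.bot_lt_coe c).trans_le (le_max_right _ _)).ne'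

/-- Truncating a continuous plurisubharmonic function from below gives a real-valued one. -/
lemma PshOnE.pshReal_toReal_max {u : En n → EReal} {U : Set (En n)} (hc : ContinuousOn u U)
    (hu : PshOnE u U) (c : ℝ) : PshReal (fun x => (max (u x) (c : EReal)).toReal) U := by
  have hcont : ContinuousOn (fun x => (max (u x) (c : EReal)).toReal) U := by
    have hm : ContinuousOn (fun x => max (u x) (c : EReal)) U := hc.sup continuousOn_const
    refine EReal.continuousOn_toReal.comp hm fun x hx => ?_
    have h1 := (max_lt (hu.2.1 x hx) (EReal.coe_lt_top c)).ne
    have h2 := ((EReal.bot_lt_coe c).trans_le (le_max_right (u x) _)).ne'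
    simp [h1, h2]
  refine ⟨hcont, fun z hz w r hr hd => ?_⟩
  have hint := integrable_circle hcont hr hd
  rw [← EReal.coe_le_coe_iff, coe_toReal_max (hu.2.1 z hz)]
  refine max_le ?_ ?_
  · rw [← eint_coe hint]
    refine (hu.2.2 z hz w r hr hd).trans (eint_mono_ae (Eventually.of_forall fun θ => ?_))
    rw [coe_toReal_max (hu.2.1 _ (circle_mem hr hd θ))]
    exact le_max_left _ _
  · rw [EReal.coe_le_coe_iff]
    have h1 : ∫ _θ, c ∂thetaM = c := by simp
    refine h1.ge.trans (integral_mono (integrable_const c) hint fun θ => ?_)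
    rw [← EReal.coe_le_coe_iff, coe_toReal_max (hu.2.1 _ (circle_mem hr hd θ))]
    exact le_max_right _ _

/-- To be a Jensen measure it is enough to test against real-valued plurisubharmonic functions. -/
lemma isJensen_of_pshReal {X : Set (En n)} (hX : IsCompact X) {z : En n} (hz : z ∈ X)
    {ν : Measure (En n)} [IsProbabilityMeasure ν] (hν : ν Xᶜ = 0)
    (h : ∀ U : Set (En n), IsOpen U → X ⊆ U → ∀ g : En n → ℝ, PshReal g U → g z ≤ ∫ x, g x ∂ν) :
    IsJensen X z ν := by
  have hae : ∀ᵐ x ∂ν, x ∈ X := hν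
  have hres : ν.restrict X = ν := Measure.restrict_eq_self_of_ae_mem hae
  refine ⟨inferInstance, hν, fun U hU hXU u hc hu => ?_⟩
  have hint : ∀ g : En n → ℝ, ContinuousOn g U → Integrable g ν := fun g hg => by
    have := (hg.mono hXU).integrableOn_compact (μ := ν) hX
    rwa [IntegrableOn, hres] at this
  refine le_eint_of_forall_le_eint_max ?_ ?_ fun k => ?_
  · rw [← hres]
    exact (hc.mono hXU).aemeasurable hX.measurableSet
  · have h0 := hint _ (hu.pshReal_toReal_max hc 0).1
    refine ne_top_of_le_ne_top h0.lintegral_lt_top.ne (lintegral_mono_ae ?_)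
    filter_upwards [hae] with x hx
    rw [← EReal.real_coe_toENNReal, coe_toReal_max (hu.2.1 x (hXU hx))]
    exact EReal.toENNReal_le_toENNReal (le_max_left _ _)
  · have hg := hu.pshReal_toReal_max hc (-(k : ℝ))
    have h1 := EReal.coe_le_coe_iff.2 (h U hU hXU _ hg)
    rw [coe_toReal_max (hu.2.1 z (hXU hz)), ← eint_coe (hint _ hg.1)] at h1
    refine (le_max_left _ _).trans (h1.trans_eq (eint_congr_ae ?_))
    filter_upwards [hae] with x hx
    rw [coe_toReal_max (hu.2.1 x (hXU hx))]

/-- The restrictions to `X` of real-valued continuous plurisubharmonic functions on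
neighborhoods of `X`. -/
def PshNear (X : Set (En n)) (g : En n → ℝ) : Prop :=
  ∃ U, IsOpen U ∧ X ⊆ U ∧ PshReal g U

namespace PshNear

variable {X : Set (En n)} {g g₁ g₂ : En n → ℝ}

lemma const (c : ℝ) : PshNear X (fun _ => c) :=
  ⟨univ, isOpen_univ, subset_univ _, PshReal.const c⟩

lemma add (h₁ : PshNear X g₁) (h₂ : PshNear X g₂) : PshNear X (fun x => g₁ x + g₂ x) := by
  obtain ⟨U, hU, hXU, h₁⟩ := h₁
  obtain ⟨V, hV, hXV, h₂⟩ := h₂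
  exact ⟨U ∩ V, hU.inter hV, subset_inter hXU hXV,
    (h₁.mono inter_subset_left).add (h₂.mono inter_subset_right)⟩

lemma sup (h₁ : PshNear X g₁) (h₂ : PshNear X g₂) : PshNear X (fun x => max (g₁ x) (g₂ x)) := by
  obtain ⟨U, hU, hXU, h₁⟩ := h₁
  obtain ⟨V, hV, hXV, h₂⟩ := h₂
  exact ⟨U ∩ V, hU.inter hV, subset_inter hXU hXV,
    (h₁.mono inter_subset_left).sup (h₂.mono inter_subset_right)⟩

lemma const_mul (hg : PshNear X g) {c : ℝ} (hc : 0 ≤ c) : PshNear X (fun x => c * g x) := by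
  obtain ⟨U, hU, hXU, hg⟩ := hg
  exact ⟨U, hU, hXU, hg.const_mul hc⟩

lemma continuousOn (hg : PshNear X g) : ContinuousOn g X := by
  obtain ⟨U, -, hXU, hg⟩ := hg
  exact hg.1.mono hXU

lemma pshcR (hg : PshNear X g) : PSHcR X g := by
  refine ⟨hg.continuousOn, ?_⟩
  obtain ⟨U, hU, hXU, hg⟩ := hg
  exact ⟨(hg.continuousOn_coe.mono hXU).upperSemicontinuousOn, fun z _ => EReal.coe_lt_top _,
    fun z _ μ hμ => hμ.2.2 U hU hXU _ hg.continuousOn_coe hg.pshOnE⟩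

end PshNear

/-- A positive normalized functional on `C(X)` dominating evaluation at `z` on plurisubharmonic
functions is evaluation at `z` when `z ∈ O_X`. -/
lemma eq_eval_of_mem_Oset {X : Set (En n)} (hX : IsCompact X) {z : En n} (hz : z ∈ Oset X)
    (L : C(X, ℝ) →ₗ[ℝ] ℝ) (hpos : ∀ f : C(X, ℝ), (∀ x, 0 ≤ f x) → 0 ≤ L f)
    (hone : L 1 = 1)
    (hpsh : ∀ g : En n → ℝ, PshNear X g → ∀ f : C(X, ℝ), (∀ x : X, f x = g x) → g z ≤ L f)
    (f : C(X, ℝ)) : L f = f ⟨z, hz.1⟩ := by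
  have : CompactSpace X := isCompact_iff_compactSpace.1 hX
  let Λ : CompactlySupportedContinuousMap X ℝ →ₚ[ℝ] ℝ := PositiveLinearMap.mk₀
    { toFun := fun f => L f.toContinuousMap
      map_add' := fun f g => L.map_add f.toContinuousMap g.toContinuousMap
      map_smul' := fun c f => L.map_smul c f.toContinuousMap }
    (fun f hf => hpos _ hf)
  have hΛ : ∀ f : C(X, ℝ), ∫ x, f x ∂(RealRMK.rieszMeasure Λ) = L f := fun f =>
    RealRMK.integral_rieszMeasure Λ (CompactlySupportedContinuousMap.continuousMapEquiv f)
  have hprob : IsProbabilityMeasure (RealRMK.rieszMeasure Λ) := by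
    have h1 := hΛ 1
    rw [hone] at h1
    constructor
    have h2 : (RealRMK.rieszMeasure Λ).real univ = 1 := by simpa using h1
    rwa [Measure.real, ENNReal.toReal_eq_one_iff] at h2
  have hmeas : Measurable (Subtype.val : X → En n) := measurable_subtype_coe
  set ν : Measure (En n) := (RealRMK.rieszMeasure Λ).map Subtype.val with hνdef
  have : IsProbabilityMeasure ν := Measure.isProbabilityMeasure_map hmeas.aemeasurable
  have hemb : MeasurableEmbedding (Subtype.val : X → En n) :=
    MeasurableEmbedding.subtype_coe hX.measurableSet
  have hJ : IsJensen X z ν := by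
    refine isJensen_of_pshReal hX hz.1 ?_ fun U hU hXU g hg => ?_
    · rw [hνdef, Measure.map_apply hmeas hX.measurableSet.compl]
      simp
    · rw [hνdef, hemb.integral_map]
      have := hpsh g ⟨U, hU, hXU, hg⟩ ⟨fun x : X => g x, (hg.1.mono hXU).domRestrict⟩ fun _ => rfl
      rwa [← hΛ] at this
  have hdirac := hz.2 ν hJ
  obtain ⟨F, hF⟩ := ContinuousMap.exists_restrict_eq hX.isClosed f
  have hFx : ∀ x : X, F x = f x := fun x => by rw [← hF]; rfl
  have h1 : ∫ x, F x ∂ν = ∫ x, f x ∂(RealRMK.rieszMeasure Λ) := by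
    rw [hνdef, hemb.integral_map]
    simp only [hFx]
  rw [← hΛ, ← h1, hdirac, integral_dirac]
  exact hFx ⟨z, hz.1⟩

/-- At a point of `O_X` a continuous function is approximated by plurisubharmonic minorants. -/
lemma exists_pshNear_lt {X : Set (En n)} (hX : IsCompact X) {z : En n} (hz : z ∈ Oset X)
    (ψ : C(X, ℝ)) (hψ : 0 < ψ ⟨z, hz.1⟩) :
    ∃ g, PshNear X g ∧ (∀ x : X, g x < ψ x) ∧ 0 ≤ g z := by
  have : CompactSpace X := isCompact_iff_compactSpace.1 hX
  by_contra hcon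
  let S : Set C(X, ℝ) := {f | ∃ g, PshNear X g ∧ (∀ x : X, g x < f x) ∧ 0 ≤ g z}
  have hSψ : ψ ∉ S := hcon
  have hsmul : ∀ f ∈ S, ∀ t : ℝ, 0 < t → t • f ∈ S := by
    rintro f ⟨g, hg, hlt, h0⟩ t ht
    exact ⟨fun x => t * g x, hg.const_mul ht.le, fun x => mul_lt_mul_of_pos_left (hlt x) ht,
      mul_nonneg ht.le h0⟩
  have hadd : ∀ f₁ ∈ S, ∀ f₂ ∈ S, f₁ + f₂ ∈ S := by
    rintro f₁ ⟨g₁, hg₁, hlt₁, h₁⟩ f₂ ⟨g₂, hg₂, hlt₂, h₂⟩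
    exact ⟨fun x => g₁ x + g₂ x, hg₁.add hg₂, fun x => add_lt_add (hlt₁ x) (hlt₂ x),
      add_nonneg h₁ h₂⟩
  have hconv : Convex ℝ S := convex_iff_forall_pos.2 fun f₁ h₁ f₂ h₂ a b ha hb _ =>
    hadd _ (hsmul _ h₁ a ha) _ (hsmul _ h₂ b hb)
  have hopen : IsOpen S := by
    have hS : S = ⋃ (g : En n → ℝ) (_ : PshNear X g ∧ 0 ≤ g z), {f | ∀ x : X, g x < f x} := by
      ext f
      simp only [S, mem_ofPred_eq, mem_iUnion, exists_prop]
      exact ⟨fun ⟨g, a, b, c⟩ => ⟨g, ⟨a, c⟩, b⟩, fun ⟨g, ⟨a, c⟩, b⟩ => ⟨g, a, b, c⟩⟩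
    rw [hS]
    refine isOpen_biUnion fun g hg => ?_
    let G : C(X, ℝ) := ⟨fun x : X => g x, hg.1.continuousOn.domRestrict⟩
    have : {f : C(X, ℝ) | ∀ x : X, g x < f x} =
        (fun f => f - G) ⁻¹' {f : C(X, ℝ) | MapsTo f univ (Ioi 0)} := by
      ext f
      simp only [MapsTo, mem_ofPred_eq, mem_preimage, mem_univ, forall_true_left, mem_Ioi,
        ContinuousMap.sub_apply, sub_pos, G]
      exact ⟨fun h x => h x, fun h x => @h x⟩
    rw [this]
    exact (ContinuousMap.isOpen_setOfPred_mapsTo isCompact_univ isOpen_Ioi).preimage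
      (continuous_id.sub continuous_const)
  obtain ⟨L, hL⟩ := geometric_hahn_banach_point_open hconv hopen hSψ
  have hLS : ∀ f ∈ S, 0 ≤ L f := by
    intro f hf
    by_contra hneg
    push Not at hneg
    have ht : 0 < |L ψ| / (-L f) + 1 := by
      have : 0 < -L f := by linarith
      positivity
    have h1 := hL _ (hsmul f hf _ ht)
    rw [map_smul, smul_eq_mul, add_mul, one_mul] at h1
    have h2 : |L ψ| / (-L f) * L f = -|L ψ| := by
      rw [div_neg, neg_mul, div_mul_cancel₀ _ hneg.ne]
    rw [h2] at h1
    linarith [neg_abs_le (L ψ)]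
  have hS1 : (1 : C(X, ℝ)) ∈ S := ⟨fun _ => 0, PshNear.const 0, fun x => by simp, le_rfl⟩
  have hLψ : L ψ ≤ 0 := by
    refine le_of_forall_pos_le_add fun δ hδ => ?_
    have h1 : 0 ≤ L 1 := hLS 1 hS1
    have h2 := hL _ (hsmul 1 hS1 (δ / (L 1 + 1)) (by positivity))
    rw [map_smul, smul_eq_mul] at h2
    have h3 : δ / (L 1 + 1) * L 1 ≤ δ := by
      rw [div_mul_eq_mul_div, div_le_iff₀ (by positivity)]
      nlinarith
    linarith
  have hLclos : ∀ f : C(X, ℝ), (∀ δ : ℝ, 0 < δ → f + δ • 1 ∈ S) → 0 ≤ L f := by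
    intro f hf
    refine le_of_forall_pos_le_add fun δ hδ => ?_
    have h1 : 0 ≤ L 1 := hLS 1 hS1
    have h2 := hLS _ (hf (δ / (L 1 + 1)) (by positivity))
    rw [map_add, map_smul, smul_eq_mul] at h2
    have h3 : δ / (L 1 + 1) * L 1 ≤ δ := by
      rw [div_mul_eq_mul_div, div_le_iff₀ (by positivity)]
      nlinarith
    linarith
  have hpos : ∀ f : C(X, ℝ), (∀ x, 0 ≤ f x) → 0 ≤ L f := fun f hf =>
    hLclos f fun δ hδ => ⟨fun _ => 0, PshNear.const 0, fun x => by
      have := hf x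
      simp
      linarith, le_rfl⟩
  have hL1 : 0 < L 1 := by
    refine (hLS 1 hS1).lt_of_ne' fun h0 => ?_
    have h1 : L ψ < 0 := h0 ▸ hL 1 hS1
    have h2 := hpos (ψ + ‖ψ‖ • 1) fun x => by
      have := neg_le_of_abs_le (ψ.norm_coe_le_norm x)
      simp
      linarith
    rw [map_add, map_smul, h0] at h2
    simp at h2
    linarith
  have hpsh : ∀ g : En n → ℝ, PshNear X g → ∀ f : C(X, ℝ), (∀ x : X, f x = g x) →
      g z * L 1 ≤ L f := by
    intro g hg f hf
    have h1 := hLclos (f + (-g z) • 1) fun δ hδ =>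
      ⟨fun x => g x + -g z, hg.add (PshNear.const _), fun x => by simp [hf x, hδ], by simp⟩
    rw [map_add, map_smul, smul_eq_mul] at h1
    linarith
  have heval := eq_eval_of_mem_Oset hX hz ((L 1)⁻¹ • (L : C(X, ℝ) →ₗ[ℝ] ℝ))
    (fun f hf => mul_nonneg (inv_nonneg.2 hL1.le) (hpos f hf))
    (by simp [hL1.ne'])
    (fun g hg f hf => by
      have := hpsh g hg f hf
      simp only [LinearMap.smul_apply, smul_eq_mul, ContinuousLinearMap.coe_coe]
      rw [inv_mul_eq_div, le_div_iff₀ hL1]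
      exact this) ψ
  simp only [LinearMap.smul_apply, smul_eq_mul, ContinuousLinearMap.coe_coe] at heval
  have : (L 1)⁻¹ * L ψ ≤ 0 := mul_nonpos_of_nonneg_of_nonpos (inv_nonneg.2 hL1.le) hLψ
  linarith

end RealPsh

/-- Lemma 4.5 (approximate solutions of the Dirichlet problem). -/
theorem stmt_10 {n : ℕ} (X : Set (En n)) (hX : IsCompact X) (hreg : IsClosed (Oset X))
    (φ : En n → ℝ) (hφ : ContinuousOn φ (Bset X)) (ε : ℝ) (hε : 0 < ε) :
    ∃ u : En n → ℝ, PSHcR X u ∧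
      (∀ w ∈ Bset X, φ w - ε ≤ u w ∧ u w ≤ φ w) ∧
      ∀ x ∈ X, sInf (φ '' Bset X) ≤ u x := by
  have hBO : Bset X = Oset X := hreg.closure_eq
  have hBX : Bset X ⊆ X := hBO ▸ fun z hz => hz.1
  have hBcl : IsClosed (Bset X) := isClosed_closure
  have hBcpt : IsCompact (Bset X) := hX.of_isClosed_subset hBcl hBX
  obtain ⟨Φ, hΦ⟩ := ContinuousMap.exists_restrict_eq hBcl
    (⟨fun x : Bset X => φ x, hφ.domRestrict⟩ : C(Bset X, ℝ))
  have hΦφ : ∀ w ∈ Bset X, Φ w = φ w := fun w hw => DFunLike.congr_fun hΦ ⟨w, hw⟩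
  have hm : ∀ w ∈ Bset X, sInf (φ '' Bset X) ≤ φ w := fun w hw =>
    csInf_le (hBcpt.image_of_continuousOn hφ).bddBelow (mem_image_of_mem φ hw)
  suffices h : ∃ u, PshNear X u ∧ (∀ w ∈ Bset X, u w ≤ φ w) ∧
      (∀ x ∈ X, sInf (φ '' Bset X) ≤ u x) ∧ ∀ w ∈ Bset X, φ w - ε ≤ u w by
    obtain ⟨u, hu, h1, h2, h3⟩ := h
    exact ⟨u, hu.pshcR, fun w hw => ⟨h3 w hw, h1 w hw⟩, h2⟩
  refine hBcpt.induction_on (p := fun s => ∃ u, PshNear X u ∧ (∀ w ∈ Bset X, u w ≤ φ w) ∧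
      (∀ x ∈ X, sInf (φ '' Bset X) ≤ u x) ∧ ∀ w ∈ s, φ w - ε ≤ u w) ?_ ?_ ?_ ?_
  · exact ⟨fun _ => sInf (φ '' Bset X), PshNear.const _, hm, fun _ _ => le_rfl, by simp⟩
  · rintro s t hst ⟨u, hu, h1, h2, h3⟩
    exact ⟨u, hu, h1, h2, fun w hw => h3 w (hst hw)⟩
  · rintro s t ⟨u, hu, h1, h2, h3⟩ ⟨v, hv, k1, k2, k3⟩
    refine ⟨fun x => max (u x) (v x), hu.sup hv, fun w hw => max_le (h1 w hw) (k1 w hw),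
      fun x hx => le_max_of_le_left (h2 x hx), ?_⟩
    rintro w (hw | hw)
    · exact le_max_of_le_left (h3 w hw)
    · exact le_max_of_le_right (k3 w hw)
  · intro z hz
    have hzO : z ∈ Oset X := hBO ▸ hz
    obtain ⟨g, hg, hlt, hgz⟩ := exists_pshNear_lt hX hzO
      ⟨fun x : X => Φ x - φ z + ε / 2, by fun_prop⟩ (by simp [hΦφ z hz, hε])
    have hgφ : ∀ w ∈ Bset X, g w < φ w - φ z + ε / 2 := fun w hw => by
      rw [← hΦφ w hw]
      exact hlt ⟨w, hBX hw⟩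
    have hu : PshNear X (fun x => max (g x + (φ z - ε / 2)) (sInf (φ '' Bset X))) :=
      (hg.add (PshNear.const _)).sup (PshNear.const _)
    refine ⟨{w | φ w - ε ≤ max (g w + (φ z - ε / 2)) (sInf (φ '' Bset X))}, ?_, _, hu, ?_,
      fun x _ => le_max_right _ _, fun w hw => hw⟩
    · have hlt' : φ z - ε < max (g z + (φ z - ε / 2)) (sInf (φ '' Bset X)) :=
        lt_max_of_lt_left (by linarith)
      have hev := ((hφ z hz).sub_const ε).eventually_lt
        ((hu.continuousOn.mono hBX) z hz) hlt'
      exact hev.mono fun w hw => hw.le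
    · intro w hw
      refine max_le ?_ (hm w hw)
      linarith [hgφ w hw]
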